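/- The distance OT_p is lower semi-continuous with respect to vague convergence: if μ_n → μ and ν_n → ν vaguely on Ω, with all measures in M^p, then OT_p(μ,ν) ≤ liminf_n OT_p(μ_n,ν_n). -/

import Mathlib

noncomputable section

open MeasureTheory Metric Set Filter Topology ENNReal
open scoped Classical

/-- The plane with the Euclidean distance. -/
abbrev Pt : Type := EuclideanSpace ℝ (Fin 2)

/-- Build a point of the plane from coordinates. -/
def mk2 (a b : ℝ) : Pt := (WithLp.equiv 2 (Fin 2 → ℝ)).symm ![a, b]

/-- The open upper half-plane Ω = {(t₁,t₂) : t₂ > t₁}. -/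
def UHP : Set Pt := {x | x 0 < x 1}

/-- The diagonal ∂Ω = {(t,t)}. -/
def Diag : Set Pt := {x | x 0 = x 1}

/-- Ω̄ = Ω ∪ ∂Ω. -/
def UHPbar : Set Pt := UHP ∪ Diag

/-- Distance from a point to the diagonal. -/
def persDist (x : Pt) : ℝ := infDist x Diag

/-- p-th total persistence Pers_p(μ) = ∫_Ω d(x,∂Ω)^p dμ(x). -/
def Pers (p : ℝ) (μ : Measure Pt) : ℝ≥0∞ :=
  ∫⁻ x in UHP, ENNReal.ofReal (persDist x ^ p) ∂μ

/-- μ ∈ M^p : a measure supported on Ω with finite p-th persistence. -/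
def MemMp (p : ℝ) (μ : Measure Pt) : Prop := μ UHPᶜ = 0 ∧ Pers p μ < ⊤

/-- Admissible partial transport plans between μ and ν: measures on Ω̄ × Ω̄ whose
marginals restricted to Ω are μ and ν. -/
def Adm (μ ν : Measure Pt) : Set (Measure (Pt × Pt)) :=
  {π | π ((UHPbar ×ˢ UHPbar)ᶜ) = 0 ∧
    (∀ A : Set Pt, MeasurableSet A → A ⊆ UHP → π (A ×ˢ univ) = μ A) ∧
    (∀ B : Set Pt, MeasurableSet B → B ⊆ UHP → π (univ ×ˢ B) = ν B)}

/-- Cost C_p(π) = ∬ d(x,y)^p dπ(x,y). -/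
def Cost (p : ℝ) (π : Measure (Pt × Pt)) : ℝ≥0∞ :=
  ∫⁻ z, ENNReal.ofReal (dist z.1 z.2 ^ p) ∂π

/-- OT_p(μ,ν)^p, as an extended real. -/
def OTe (p : ℝ) (μ ν : Measure Pt) : ℝ≥0∞ := ⨅ π ∈ Adm μ ν, Cost p π

/-- The optimal partial transport distance OT_p(μ,ν). -/
def OT (p : ℝ) (μ ν : Measure Pt) : ℝ := (OTe p μ ν ^ (1 / p)).toReal

/-- Optimal plans. -/
def OptSet (p : ℝ) (μ ν : Measure Pt) : Set (Measure (Pt × Pt)) :=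
  {π | π ∈ Adm μ ν ∧ Cost p π = OTe p μ ν}

/-- Vague convergence of measures on Ω: convergence of integrals of continuous
functions compactly supported in Ω. -/
def VagueTendsto (μs : ℕ → Measure Pt) (μ : Measure Pt) : Prop :=
  ∀ f : Pt → ℝ, Continuous f → HasCompactSupport f → tsupport f ⊆ UHP →
    Tendsto (fun n => ∫ x, f x ∂(μs n)) atTop (𝓝 (∫ x, f x ∂μ))

/-- E_Ω = (Ω̄ × Ω̄) \ (∂Ω × ∂Ω). -/
def EOm : Set (Pt × Pt) := (UHPbar ×ˢ UHPbar) \ (Diag ×ˢ Diag)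

/-- Vague convergence of plans on E_Ω. -/
def VaguePlanTendsto (πs : ℕ → Measure (Pt × Pt)) (π : Measure (Pt × Pt)) : Prop :=
  ∀ f : Pt × Pt → ℝ, Continuous f → HasCompactSupport f → tsupport f ⊆ EOm →
    Tendsto (fun n => ∫ z, f z ∂(πs n)) atTop (𝓝 (∫ z, f z ∂π))

/-- A persistence diagram: an ℕ-valued point measure Σ_{x ∈ X} n_x δ_x with
X ⊆ Ω locally finite in Ω. -/
def IsDiagram (μ : Measure Pt) : Prop :=
  ∃ (X : Set Pt) (n : Pt → ℕ), X ⊆ UHP ∧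
    (∀ x ∈ UHP, ∃ U ∈ 𝓝 x, (X ∩ U).Finite) ∧
    μ = Measure.sum (fun x : X => (n x.1 : ℝ≥0∞) • Measure.dirac (x.1 : Pt))

/-- Support of a measure on Pt × Pt. -/
def msupp (π : Measure (Pt × Pt)) : Set (Pt × Pt) := {z | ∀ U ∈ 𝓝 z, π U ≠ 0}

/-- Support of a measure on Pt. -/
def suppM (μ : Measure Pt) : Set Pt := {x | ∀ U ∈ 𝓝 x, μ U ≠ 0}

/-- Bottleneck cost of a plan: sup of d(x,y) over the support. -/
def CostInf (π : Measure (Pt × Pt)) : ℝ≥0∞ :=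
  ⨆ z ∈ msupp π, ENNReal.ofReal (dist z.1 z.2)

/-- The bottleneck (∞) optimal partial transport distance, as extended real. -/
def OTinfE (μ ν : Measure Pt) : ℝ≥0∞ := ⨅ π ∈ Adm μ ν, CostInf π

/-- μ ∈ M^∞ : support at bounded distance from the diagonal. -/
def MemMinf (μ : Measure Pt) : Prop :=
  μ UHPᶜ = 0 ∧ ∃ C : ℝ, ∀ x ∈ suppM μ, persDist x ≤ C

/-- A partial matching between two indexed families: a bijection between
subsets of the index sets; unmatched points are sent to the diagonal. -/
structure Matching (ι κ : Type*) where
  I : Set ι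
  J : Set κ
  e : I ≃ J

/-- Cost of a partial matching for d_p (as the p-th power, extended real). -/
def mCost (p : ℝ) {ι κ : Type*} (x : ι → Pt) (y : κ → Pt) (m : Matching ι κ) : ℝ≥0∞ :=
  (∑' i : m.I, ENNReal.ofReal (dist (x i.1) (y (m.e i).1) ^ p))
  + (∑' i : ↥(m.Iᶜ), ENNReal.ofReal (persDist (x i.1) ^ p))
  + (∑' j : ↥(m.Jᶜ), ENNReal.ofReal (persDist (y j.1) ^ p))

/-- Bottleneck cost of a partial matching. -/
def mCostInf {ι κ : Type*} (x : ι → Pt) (y : κ → Pt) (m : Matching ι κ) : ℝ≥0∞ :=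
  (⨆ i : m.I, ENNReal.ofReal (dist (x i.1) (y (m.e i).1)))
  ⊔ (⨆ i : ↥(m.Iᶜ), ENNReal.ofReal (persDist (x i.1)))
  ⊔ (⨆ j : ↥(m.Jᶜ), ENNReal.ofReal (persDist (y j.1)))

/-- The point measure associated to an indexed family of points. -/
def famMeasure {ι : Type*} (x : ι → Pt) : Measure Pt :=
  Measure.sum (fun i => Measure.dirac (x i))

/-- The weighted measure μ^p, with density d(x,∂Ω)^p with respect to μ. -/
def wgt (p : ℝ) (μ : Measure Pt) : Measure Pt :=
  μ.withDensity (fun x => ENNReal.ofReal (persDist x ^ p))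

/-- The quotient space Ω̃ = Ω ⊔ {∂Ω}. -/
def Qt : Type := Option ↥UHP

/-- The quotient metric ρ on Ω̃. -/
def ρQ : Qt → Qt → ℝ
  | some x, some y => min (dist (x : Pt) (y : Pt)) (persDist x + persDist y)
  | some x, none => persDist x
  | none, some y => persDist y
  | none, none => 0

/-- The quotient metric ρ viewed on the plane, all diagonal points being
identified. -/
def ρP (x y : Pt) : ℝ :=
  if x ∈ Diag then (if y ∈ Diag then 0 else persDist y)
  else if y ∈ Diag then persDist x
  else min (dist x y) (persDist x + persDist y)

/-- Couplings with full (equal-mass) marginals. -/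
def Coup (μ ν : Measure Pt) : Set (Measure (Pt × Pt)) :=
  {π | π.map Prod.fst = μ ∧ π.map Prod.snd = ν}

/-- The p-Wasserstein distance (to the p) for the quotient metric ρ. -/
def WpE (p : ℝ) (μ ν : Measure Pt) : ℝ≥0∞ :=
  ⨅ π ∈ Coup μ ν, ∫⁻ z, ENNReal.ofReal (ρP z.1 z.2 ^ p) ∂π


open scoped NNReal CompactlySupported

section General

variable {X : Type*} [TopologicalSpace X] [T2Space X] [LocallyCompactSpace X]
  [MeasurableSpace X] [BorelSpace X]

/-- An NNReal-valued bump function. -/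
lemma exists_bump {K V : Set X} (hK : IsCompact K) (hV : IsOpen V) (hKV : K ⊆ V) :
    ∃ f : X → ℝ≥0, Continuous f ∧ HasCompactSupport f ∧ tsupport f ⊆ V ∧
      (∀ x ∈ K, f x = 1) ∧ ∀ x, f x ≤ 1 := by
  obtain ⟨f, hf1, hf2, hf3, hf4⟩ := exists_continuousMap_one_of_isCompact_subset_isOpen hK hV hKV
  have hsub : tsupport (fun x => Real.toNNReal (f x)) ⊆ tsupport f := by
    apply closure_mono
    intro x hx
    simp only [Function.mem_support] at hx ⊢
    intro h
    exact hx (by simp [h])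
  refine ⟨fun x => Real.toNNReal (f x), by fun_prop, ?_, hsub.trans hf3, ?_, ?_⟩
  · exact HasCompactSupport.comp_left (f := f) hf2 (g := Real.toNNReal) (by simp)
  · intro x hx
    have := hf1 hx
    simp at this
    simp [this]
  · intro x
    have := (hf4 x).2
    simpa using this

/-- Ultrafilter vague limits of locally uniformly bounded sequences of measures. -/
lemma exists_vague_limit (U : Ultrafilter ℕ) (πs : ℕ → Measure X)
    (hb : ∀ K : Set X, IsCompact K → ∃ C : ℝ≥0, ∀ᶠ n in (U : Filter ℕ), πs n K ≤ C) :
    ∃ π : Measure X, ∀ f : X → ℝ≥0, Continuous f → HasCompactSupport f →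
      Tendsto (fun n => ∫⁻ x, f x ∂(πs n)) U (𝓝 (∫⁻ x, f x ∂π)) := by
  have hlim : ∀ f : C_c(X, ℝ≥0), ∃ a : ℝ≥0,
      Tendsto (fun n => ∫⁻ x, f x ∂(πs n)) U (𝓝 (a : ℝ≥0∞)) := by
    intro f
    obtain ⟨C, hC⟩ := hb _ f.hasCompactSupport
    obtain ⟨M, hM⟩ : ∃ M : ℝ≥0, ∀ x, f x ≤ M := by
      obtain ⟨M, hM⟩ := (f.hasCompactSupport.isCompact_range f.continuous).bddAbove
      exact ⟨M, fun x => hM (mem_range_self x)⟩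
    have hle : ∀ᶠ n in (U : Filter ℕ), ∫⁻ x, f x ∂(πs n) ≤ ((M * C : ℝ≥0) : ℝ≥0∞) := by
      filter_upwards [hC] with n hn
      calc ∫⁻ x, f x ∂(πs n) ≤ ∫⁻ x, (tsupport f).indicator (fun _ => (M : ℝ≥0∞)) x ∂(πs n) := by
            apply lintegral_mono
            intro x
            by_cases hx : x ∈ tsupport f
            · simp [hx, hM x]
            · simp [hx, image_eq_zero_of_notMem_tsupport hx]
        _ = M * πs n (tsupport f) := by
            rw [lintegral_indicator_const (isClosed_tsupport f).measurableSet]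
        _ ≤ ((M * C : ℝ≥0) : ℝ≥0∞) := by push_cast; gcongr
    obtain ⟨a, ha, hta⟩ := (isCompact_Icc (a := (0 : ℝ≥0∞)) (b := ((M * C : ℝ≥0) : ℝ≥0∞))).ultrafilter_le_nhds
      (U.map (fun n => ∫⁻ x, f x ∂(πs n))) (by
        rw [le_principal_iff]
        filter_upwards [hle] with n hn
        exact ⟨zero_le, hn⟩)
    refine ⟨a.toNNReal, ?_⟩
    rw [ENNReal.coe_toNNReal (ne_top_of_le_ne_top ENNReal.coe_ne_top ha.2)]
    exact hta
  choose a ha using hlim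
  let Λ : C_c(X, ℝ≥0) →ₗ[ℝ≥0] ℝ≥0 :=
    { toFun := a
      map_add' := by
        intro f g
        have h1 := (ha f).add (ha g)
        have h2 := ha (f + g)
        have h3 : (fun n => ∫⁻ x, (f + g) x ∂(πs n)) =
            fun n => ∫⁻ x, f x ∂(πs n) + ∫⁻ x, g x ∂(πs n) := by
          ext n
          rw [← lintegral_add_left (by have := f.continuous; fun_prop)]
          simp
        rw [h3] at h2
        have := tendsto_nhds_unique h2 h1
        exact_mod_cast this
      map_smul' := by
        intro c f
        have h1 := ENNReal.Tendsto.const_mul (a := (c : ℝ≥0∞)) (ha f) (Or.inr ENNReal.coe_ne_top)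
        have h2 := ha (c • f)
        have h3 : (fun n => ∫⁻ x, (c • f) x ∂(πs n)) =
            fun n => c * ∫⁻ x, f x ∂(πs n) := by
          ext n
          rw [← lintegral_const_mul _ (by have := f.continuous; fun_prop)]
          simp
        rw [h3] at h2
        have := tendsto_nhds_unique h2 h1
        simp only [RingHom.id_apply, smul_eq_mul]
        exact_mod_cast this }
  refine ⟨NNRealRMK.rieszMeasure Λ, fun f hf hfc => ?_⟩
  have h := ha ⟨⟨f, hf⟩, hfc⟩
  have h2 := NNRealRMK.lintegral_rieszMeasure Λ ⟨⟨f, hf⟩, hfc⟩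
  change ∫⁻ x, (f x : ℝ≥0∞) ∂_ = (a ⟨⟨f, hf⟩, hfc⟩ : ℝ≥0∞) at h2
  rw [h2]
  exact h

/-- Lower semicontinuity of integrals of nonnegative continuous functions. -/
lemma vague_lsc [SigmaCompactSpace X] (U : Ultrafilter ℕ) (πs : ℕ → Measure X) (π : Measure X)
    (h : ∀ f : X → ℝ≥0, Continuous f → HasCompactSupport f →
      Tendsto (fun n => ∫⁻ x, f x ∂(πs n)) U (𝓝 (∫⁻ x, f x ∂π)))
    (c : X → ℝ≥0) (hc : Continuous c) (b : ℕ → ℝ≥0∞) (C : ℝ≥0∞)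
    (hb : ∀ᶠ n in (U : Filter ℕ), ∫⁻ x, c x ∂(πs n) ≤ b n)
    (hbC : Tendsto b U (𝓝 C)) : ∫⁻ x, c x ∂π ≤ C := by
  have hK : ∀ K : Set X, IsCompact K → ∫⁻ x in K, c x ∂π ≤ C := by
    intro K hK
    obtain ⟨f, hf1, hf2, -, hf3, hf4⟩ := exists_bump hK isOpen_univ (subset_univ K)
    have hlim := h (fun x => f x * c x) (hf1.mul hc) hf2.mul_right
    calc ∫⁻ x in K, c x ∂π = ∫⁻ x in K, ((f x * c x : ℝ≥0) : ℝ≥0∞) ∂π := by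
          apply setLIntegral_congr_fun hK.measurableSet
          intro x hx
          simp [hf3 x hx]
      _ ≤ ∫⁻ x, ((f x * c x : ℝ≥0) : ℝ≥0∞) ∂π := setLIntegral_le_lintegral _ _
      _ ≤ C := by
          refine le_of_tendsto_of_tendsto hlim hbC ?_
          filter_upwards [hb] with n hn
          refine le_trans (lintegral_mono fun x => ?_) hn
          have := mul_le_mul_left (hf4 x) (c x)
          rw [one_mul] at this
          exact ENNReal.coe_le_coe.2 this
  have hu := iUnion_compactCovering X
  rw [← setLIntegral_univ, ← hu, setLIntegral_iUnion_of_directed _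
    (directed_of_isDirected_le (compactCovering_subset X))]
  exact iSup_le fun n => hK _ (isCompact_compactCovering X n)

end General

lemma isOpen_UHP : IsOpen UHP := by
  unfold UHP
  exact isOpen_lt (by fun_prop) (by fun_prop)

lemma isClosed_Diag : IsClosed Diag := by
  unfold Diag
  exact isClosed_eq (by fun_prop) (by fun_prop)

lemma UHPbar_eq : UHPbar = {x : Pt | x 0 ≤ x 1} := by
  ext x
  simp only [UHPbar, UHP, Diag, mem_union, mem_ofPred_eq]
  exact le_iff_lt_or_eq.symm

lemma isClosed_UHPbar : IsClosed UHPbar := by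
  rw [UHPbar_eq]
  exact isClosed_le (by fun_prop) (by fun_prop)

lemma isLocallyClosed_EOm : IsLocallyClosed EOm := by
  unfold EOm
  rw [sdiff_eq]
  exact (isClosed_UHPbar.prod isClosed_UHPbar).isLocallyClosed.inter
    (isClosed_Diag.prod isClosed_Diag).isOpen_compl.isLocallyClosed

lemma measurableSet_EOm : MeasurableSet EOm :=
  (isClosed_UHPbar.prod isClosed_UHPbar).measurableSet.diff
    (isClosed_Diag.prod isClosed_Diag).measurableSet

lemma not_mem_Diag {x : Pt} (hx : x ∈ UHP) : x ∉ Diag := by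
  simp only [UHP, Diag, mem_ofPred_eq] at *
  exact hx.ne

lemma persDist_pos {x : Pt} (hx : x ∈ UHP) : 0 < persDist x := by
  have hne : Diag.Nonempty := ⟨0, by simp [Diag]⟩
  exact (isClosed_Diag.notMem_iff_infDist_pos hne).1 (not_mem_Diag hx)

lemma continuous_persDist : Continuous persDist := continuous_infDist_pt _

lemma MemMp.compact_lt_top {p : ℝ} (hp : 1 ≤ p) {μ : Measure Pt} (hμ : MemMp p μ) {K : Set Pt}
    (hK : IsCompact K) (hKU : K ⊆ UHP) : μ K < ⊤ := by
  rcases K.eq_empty_or_nonempty with rfl | hne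
  · simp
  obtain ⟨x₀, hx₀, hmin⟩ := hK.exists_isMinOn hne continuous_persDist.continuousOn
  have hpos := persDist_pos (hKU hx₀)
  set e : ℝ≥0∞ := ENNReal.ofReal (persDist x₀ ^ p) with he
  have he0 : e ≠ 0 := by
    simp only [he, ne_eq, ENNReal.ofReal_eq_zero, not_le]
    positivity
  have h : e * μ K ≤ Pers p μ := by
    calc e * μ K = ∫⁻ x in K, e ∂μ := by simp
      _ ≤ ∫⁻ x in K, ENNReal.ofReal (persDist x ^ p) ∂μ := by
          apply setLIntegral_mono' hK.measurableSet
          intro x hx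
          exact ENNReal.ofReal_le_ofReal
            (Real.rpow_le_rpow hpos.le (hmin hx) (by linarith))
      _ ≤ Pers p μ := lintegral_mono_set hKU
  by_contra hcon
  rw [not_lt, top_le_iff] at hcon
  rw [hcon, ENNReal.mul_top he0] at h
  exact absurd hμ.2 (not_lt.2 h)

lemma lintegral_cc_lt_top {μ : Measure Pt} (hμ : ∀ K : Set Pt, IsCompact K → K ⊆ UHP → μ K < ⊤)
    (g : Pt → ℝ≥0) (hg : Continuous g) (hgc : HasCompactSupport g) (hgU : tsupport g ⊆ UHP) :
    ∫⁻ x, g x ∂μ < ⊤ := by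
  obtain ⟨M, hM⟩ : ∃ M : ℝ≥0, ∀ x, g x ≤ M := by
    obtain ⟨M, hM⟩ := (hgc.isCompact_range hg).bddAbove
    exact ⟨M, fun x => hM (mem_range_self x)⟩
  calc ∫⁻ x, g x ∂μ ≤ ∫⁻ x, (tsupport g).indicator (fun _ => (M : ℝ≥0∞)) x ∂μ := by
        apply lintegral_mono
        intro x
        by_cases hx : x ∈ tsupport g
        · simp [hx, hM x]
        · simp [hx, image_eq_zero_of_notMem_tsupport hx]
    _ = M * μ (tsupport g) := by
        rw [lintegral_indicator_const (isClosed_tsupport g).measurableSet]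
    _ < ⊤ := ENNReal.mul_lt_top ENNReal.coe_lt_top (hμ _ hgc hgU)

lemma vague_lintegral {p : ℝ} (hp : 1 ≤ p) {μs : ℕ → Measure Pt} {μ : Measure Pt}
    (hμs : ∀ n, MemMp p (μs n)) (hμ : MemMp p μ) (hv : VagueTendsto μs μ)
    (g : Pt → ℝ≥0) (hg : Continuous g) (hgc : HasCompactSupport g) (hgU : tsupport g ⊆ UHP) :
    Tendsto (fun n => ∫⁻ x, g x ∂(μs n)) atTop (𝓝 (∫⁻ x, g x ∂μ)) := by
  have hsub : tsupport (fun x => (g x : ℝ)) ⊆ tsupport g := by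
    apply closure_mono
    intro x hx
    simpa [Function.mem_support] using hx
  have h := hv (fun x => (g x : ℝ)) (by fun_prop)
    (hgc.comp_left (g := fun t : ℝ≥0 => (t : ℝ)) (by simp)) (hsub.trans hgU)
  have key : ∀ m : Measure Pt, MemMp p m →
      ∫⁻ x, g x ∂m = ENNReal.ofReal (∫ x, (g x : ℝ) ∂m) := by
    intro m hm
    have hfin := lintegral_cc_lt_top (fun K hK hKU => hm.compact_lt_top hp hK hKU) g hg hgc hgU
    rw [lintegral_coe_eq_integral]
    refine ⟨by fun_prop, ?_⟩
    simpa [HasFiniteIntegral] using hfin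
  rw [key μ hμ]
  simp_rw [fun n => key (μs n) (hμs n)]
  exact (ENNReal.continuous_ofReal.tendsto _).comp h

lemma vague_bdd {p : ℝ} (hp : 1 ≤ p) {μs : ℕ → Measure Pt} {μ : Measure Pt}
    (hμs : ∀ n, MemMp p (μs n)) (hμ : MemMp p μ) (hv : VagueTendsto μs μ)
    {K : Set Pt} (hK : IsCompact K) (hKU : K ⊆ UHP) :
    ∃ C : ℝ≥0, ∀ᶠ n in atTop, μs n K ≤ C := by
  obtain ⟨g, hg, hgc, hgU, hg1, -⟩ := exists_bump hK isOpen_UHP hKU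
  have h := vague_lintegral hp hμs hμ hv g hg hgc hgU
  have hfin := lintegral_cc_lt_top (fun K hK hKU => hμ.compact_lt_top hp hK hKU) g hg hgc hgU
  obtain ⟨C, hC, -⟩ := ENNReal.lt_iff_exists_nnreal_btwn.1 hfin
  refine ⟨C, ?_⟩
  filter_upwards [h.eventually (gt_mem_nhds hC)] with n hn
  refine le_trans ?_ hn.le
  calc μs n K = ∫⁻ x in K, 1 ∂(μs n) := by simp
    _ = ∫⁻ x in K, g x ∂(μs n) := by
        apply setLIntegral_congr_fun hK.measurableSet
        intro x hx
        simp [hg1 x hx]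
    _ ≤ _ := setLIntegral_le_lintegral _ _

/-- Measures on the half plane are determined by integrals of compactly supported functions. -/
lemma measure_eq_on_UHP {m₁ m₂ : Measure Pt}
    (hfin : ∀ K : Set Pt, IsCompact K → K ⊆ UHP → m₂ K < ⊤)
    (h : ∀ g : Pt → ℝ≥0, Continuous g → HasCompactSupport g → tsupport g ⊆ UHP →
      ∫⁻ x, g x ∂m₁ = ∫⁻ x, g x ∂m₂)
    {A : Set Pt} (hA : MeasurableSet A) (hAU : A ⊆ UHP) : m₁ A = m₂ A := by
  have hfin1 : ∀ K : Set Pt, IsCompact K → K ⊆ UHP → m₁ K < ⊤ := by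
    intro K hK hKU
    obtain ⟨g, hg, hgc, hgU, hg1, -⟩ := exists_bump hK isOpen_UHP hKU
    calc m₁ K = ∫⁻ x in K, 1 ∂m₁ := by simp
      _ = ∫⁻ x in K, g x ∂m₁ := by
          apply setLIntegral_congr_fun hK.measurableSet
          intro x hx
          simp [hg1 x hx]
      _ ≤ ∫⁻ x, g x ∂m₁ := setLIntegral_le_lintegral _ _
      _ = ∫⁻ x, g x ∂m₂ := h g hg hgc hgU
      _ < ⊤ := lintegral_cc_lt_top hfin g hg hgc hgU
  have hemb : MeasurableEmbedding (Subtype.val : UHP → Pt) :=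
    MeasurableEmbedding.subtype_coe isOpen_UHP.measurableSet
  have : LocallyCompactSpace UHP := isOpen_UHP.isLocallyClosed.locallyCompactSpace
  have hf : ∀ m : Measure Pt, (∀ K : Set Pt, IsCompact K → K ⊆ UHP → m K < ⊤) →
      IsFiniteMeasureOnCompacts (m.comap (Subtype.val : UHP → Pt)) := by
    intro m hm
    refine ⟨fun K hK => ?_⟩
    rw [hemb.comap_apply]
    exact hm _ (hK.image continuous_subtype_val) (by simp)
  have := hf m₁ hfin1
  have := hf m₂ hfin
  have heq : m₁.comap (Subtype.val : UHP → Pt) = m₂.comap (Subtype.val : UHP → Pt) := by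
    apply Measure.ext_of_integral_eq_on_compactlySupported_nnreal
    intro f
    set g : Pt → ℝ≥0 := Function.extend Subtype.val f 0 with hgdef
    have hg : Continuous g := f.hasCompactSupport.continuous_extend_zero isOpen_UHP f.continuous
    have hgsub : tsupport g ⊆ Subtype.val '' tsupport f :=
      f.hasCompactSupport.tsupport_extend_zero_subset continuous_subtype_val
    have hgc : HasCompactSupport g :=
      (f.hasCompactSupport.isCompact.image continuous_subtype_val).of_isClosed_subset
        (isClosed_tsupport g) hgsub
    have hgU : tsupport g ⊆ UHP := hgsub.trans (by simp)
    have hgf : ∀ x : UHP, g x = f x := fun x => Subtype.val_injective.extend_apply _ _ _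
    have h0 : ∀ x, x ∉ UHP → g x = 0 := fun x hx =>
      image_eq_zero_of_notMem_tsupport fun hx' => hx (hgU hx')
    have key : ∀ m : Measure Pt,
        ∫⁻ x, f x ∂(m.comap (Subtype.val : UHP → Pt)) = ∫⁻ x, g x ∂m := by
      intro m
      simp_rw [← hgf]
      rw [← hemb.lintegral_map (fun x => (g x : ℝ≥0∞)), hemb.map_comap, Subtype.range_coe]
      apply setLIntegral_eq_of_support_subset
      intro x hx
      by_contra hcon
      simp [h0 x hcon] at hx
    have h2 : ∫⁻ x, f x ∂(m₁.comap (Subtype.val : UHP → Pt)) =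
        ∫⁻ x, f x ∂(m₂.comap (Subtype.val : UHP → Pt)) := by
      rw [key, key, h g hg hgc hgU]
    have hfm : Continuous f := f.continuous
    rw [integral_eq_lintegral_of_nonneg_ae (by filter_upwards with x; simp) (by fun_prop),
      integral_eq_lintegral_of_nonneg_ae (by filter_upwards with x; simp) (by fun_prop)]
    simpa using congrArg ENNReal.toReal h2
  have hA' : Subtype.val '' ((Subtype.val : UHP → Pt) ⁻¹' A) = A := by
    rw [Subtype.image_preimage_coe, inter_eq_right.2 hAU]
  have := congrArg (fun m => m ((Subtype.val : UHP → Pt) ⁻¹' A)) heq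
  simpa only [hemb.comap_apply, hA'] using this

/-- Limit plans have the limit marginal. -/
lemma marginal_limit {X : Type*} [TopologicalSpace X] [T2Space X] [LocallyCompactSpace X]
    [MeasurableSpace X] [BorelSpace X] [SigmaCompactSpace X]
    {p : ℝ} (hp : 1 ≤ p) {μs : ℕ → Measure Pt} {μ : Measure Pt}
    (hμs : ∀ n, MemMp p (μs n)) (hμ : MemMp p μ) (hv : VagueTendsto μs μ)
    (U : Ultrafilter ℕ) (hU : (U : Filter ℕ) ≤ atTop) (πs : ℕ → Measure X) (π : Measure X)
    (hlim : ∀ f : X → ℝ≥0, Continuous f → HasCompactSupport f →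
      Tendsto (fun n => ∫⁻ x, f x ∂(πs n)) U (𝓝 (∫⁻ x, f x ∂π)))
    (q : X → Pt) (hq : Continuous q) (c : X → ℝ≥0) (hc : Continuous c)
    (hproper : ∀ K : Set Pt, IsCompact K → K ⊆ UHP → ∀ M : ℝ≥0, IsCompact {z | q z ∈ K ∧ c z ≤ M})
    (L : ℝ≥0) (hL : ∀ᶠ n in (U : Filter ℕ), ∫⁻ z, c z ∂(πs n) ≤ L)
    (hmarg : ∀ᶠ n in (U : Filter ℕ), ∀ g : Pt → ℝ≥0, Continuous g → HasCompactSupport g →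
      tsupport g ⊆ UHP → ∫⁻ z, g (q z) ∂(πs n) = ∫⁻ x, g x ∂(μs n))
    {A : Set Pt} (hA : MeasurableSet A) (hAU : A ⊆ UHP) : π (q ⁻¹' A) = μ A := by
  rw [← Measure.map_apply hq.measurable hA]
  refine measure_eq_on_UHP (fun K hK hKU => hμ.compact_lt_top hp hK hKU) ?_ hA hAU
  intro g hg hgc hgU
  rw [lintegral_map (by fun_prop) hq.measurable]
  have hgv := (vague_lintegral hp hμs hμ hv g hg hgc hgU).mono_left hU
  apply le_antisymm
  · refine vague_lsc U πs π hlim (fun z => g (q z)) (hg.comp hq) _ _ ?_ hgv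
    filter_upwards [hmarg] with n hn
    exact (hn g hg hgc hgU).le
  · obtain ⟨M, hM⟩ : ∃ M : ℝ≥0, ∀ x, g x ≤ M := by
      obtain ⟨M, hM⟩ := (hgc.isCompact_range hg).bddAbove
      exact ⟨M, fun x => hM (mem_range_self x)⟩
    have key : ∀ e : ℝ≥0, 0 < e →
        ∫⁻ x, g x ∂μ ≤ ∫⁻ z, g (q z) ∂π + ((e * (M * L) : ℝ≥0) : ℝ≥0∞) := by
      intro e he
      have hl := hlim (fun z => g (q z) * (1 - e * c z)) (by fun_prop) (by
        refine HasCompactSupport.intro (hproper (tsupport g) hgc hgU e⁻¹) ?_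
        intro z hz
        by_cases h1 : q z ∈ tsupport g
        · have h2 : e⁻¹ < c z := by
            by_contra hcon
            exact hz ⟨h1, not_lt.1 hcon⟩
          have h3 : 1 ≤ e * c z := by
            calc (1 : ℝ≥0) = e * e⁻¹ := (mul_inv_cancel₀ he.ne').symm
              _ ≤ e * c z := by gcongr
          simp [tsub_eq_zero_of_le h3]
        · simp [image_eq_zero_of_notMem_tsupport h1])
      have hl2 := hl.add_const ((e * (M * L) : ℝ≥0) : ℝ≥0∞)
      refine (le_of_tendsto_of_tendsto hgv hl2 ?_).trans ?_
      · filter_upwards [hmarg, hL] with n hn hLn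
        rw [← hn g hg hgc hgU]
        calc ∫⁻ z, g (q z) ∂(πs n)
            ≤ ∫⁻ z, ((g (q z) * (1 - e * c z) : ℝ≥0) : ℝ≥0∞) + ((e * M : ℝ≥0) : ℝ≥0∞) * c z
                ∂(πs n) := by
              apply lintegral_mono
              intro z
              have : g (q z) ≤ g (q z) * (1 - e * c z) + e * M * c z := by
                calc g (q z) = g (q z) * 1 := (mul_one _).symm
                  _ ≤ g (q z) * ((1 - e * c z) + e * c z) := by
                      gcongr
                      exact le_tsub_add
                  _ = g (q z) * (1 - e * c z) + e * g (q z) * c z := by ring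
                  _ ≤ _ := by gcongr; exact hM _
              dsimp only
              exact_mod_cast this
          _ = ∫⁻ z, ((g (q z) * (1 - e * c z) : ℝ≥0) : ℝ≥0∞) ∂(πs n) +
                ((e * M : ℝ≥0) : ℝ≥0∞) * ∫⁻ z, c z ∂(πs n) := by
              rw [lintegral_add_left (by fun_prop), lintegral_const_mul _ (by fun_prop)]
          _ ≤ _ := by
              rw [← mul_assoc, ENNReal.coe_mul (e * M) L]
              gcongr
      · gcongr with z
        exact mul_le_of_le_one_right zero_le tsub_le_self
    refine ENNReal.le_of_forall_pos_le_add fun ε hε _ => ?_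
    have hpos : 0 < ε / (M * L + 1) := by positivity
    refine (key _ hpos).trans ?_
    gcongr
    calc ε / (M * L + 1) * (M * L) ≤ ε / (M * L + 1) * (M * L + 1) := by gcongr; simp
      _ = ε := by field_simp

lemma embEOm : MeasurableEmbedding (Subtype.val : EOm → Pt × Pt) :=
  MeasurableEmbedding.subtype_coe measurableSet_EOm

/-- The NNReal-valued cost on `EOm`. -/
def costN (p : ℝ) (z : EOm) : ℝ≥0 := nndist z.1.1 z.1.2 ^ p

lemma coe_costN {p : ℝ} (hp : 1 ≤ p) (z : EOm) :
    (costN p z : ℝ≥0∞) = ENNReal.ofReal (dist z.1.1 z.1.2 ^ p) := by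
  rw [costN, ← coe_nndist, ← NNReal.coe_rpow, ENNReal.ofReal_coe_nnreal]

lemma continuous_costN {p : ℝ} (hp : 1 ≤ p) : Continuous (costN p) := by
  unfold costN
  have h : Continuous fun t : ℝ≥0 => t ^ p := NNReal.continuous_rpow_const (by linarith)
  exact h.comp (by fun_prop)

lemma cost_comap_le {p : ℝ} (hp : 1 ≤ p) (π : Measure (Pt × Pt)) :
    ∫⁻ z, costN p z ∂(π.comap (Subtype.val : EOm → Pt × Pt)) ≤ Cost p π := by
  simp_rw [coe_costN hp]
  rw [← embEOm.lintegral_map (fun w : Pt × Pt => ENNReal.ofReal (dist w.1 w.2 ^ p)),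
    embEOm.map_comap]
  exact setLIntegral_le_lintegral _ _

lemma plan_marg {π : Measure (Pt × Pt)} {μ : Measure Pt} (hμ0 : μ UHPᶜ = 0)
    (hsupp : π ((UHPbar ×ˢ UHPbar)ᶜ) = 0)
    (q : Pt × Pt → Pt) (hq : Measurable q) (hqD : ∀ z ∈ Diag ×ˢ Diag, q z ∈ Diag)
    (hm : ∀ A : Set Pt, MeasurableSet A → A ⊆ UHP → π (q ⁻¹' A) = μ A)
    (g : Pt → ℝ≥0) (hg : Continuous g) (hgU : tsupport g ⊆ UHP) :
    ∫⁻ z, g (q z.1) ∂(π.comap (Subtype.val : EOm → Pt × Pt)) = ∫⁻ x, g x ∂μ := by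
  have h0 : ∀ x, x ∉ UHP → g x = 0 := fun x hx =>
    image_eq_zero_of_notMem_tsupport fun hx' => hx (hgU hx')
  have hsub : Function.support (fun x => (g x : ℝ≥0∞)) ⊆ UHP := by
    intro x hx
    by_contra hcon
    simp [h0 x hcon] at hx
  have hres : (π.map q).restrict UHP = μ.restrict UHP := by
    ext A hA
    rw [Measure.restrict_apply hA, Measure.restrict_apply hA,
      Measure.map_apply hq (hA.inter isOpen_UHP.measurableSet)]
    exact hm _ (hA.inter isOpen_UHP.measurableSet) inter_subset_right
  rw [← embEOm.lintegral_map (fun w : Pt × Pt => (g (q w) : ℝ≥0∞)), embEOm.map_comap,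
    Subtype.range_coe]
  calc ∫⁻ w in EOm, g (q w) ∂π = ∫⁻ w, g (q w) ∂π := by
        rw [← lintegral_indicator measurableSet_EOm]
        apply lintegral_congr_ae
        have : ∀ᵐ w ∂π, w ∈ UHPbar ×ˢ UHPbar := hsupp
        filter_upwards [this] with w hw
        by_cases hwE : w ∈ EOm
        · simp [hwE]
        · have hwD : w ∈ Diag ×ˢ Diag := by
            by_contra hcon
            exact hwE ⟨hw, hcon⟩
          have : q w ∉ UHP := fun h => not_mem_Diag h (hqD w hwD)
          simp [hwE, h0 _ this]
    _ = ∫⁻ x, g x ∂(π.map q) := 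
        (lintegral_map (f := fun x => (g x : ℝ≥0∞)) (by fun_prop) hq).symm
    _ = ∫⁻ x in UHP, g x ∂(π.map q) := (setLIntegral_eq_of_support_subset hsub).symm
    _ = ∫⁻ x in UHP, g x ∂μ := by rw [hres]
    _ = ∫⁻ x, g x ∂μ := setLIntegral_eq_of_support_subset hsub

lemma costN_proper {p : ℝ} (hp : 1 ≤ p) (q : Pt × Pt → Pt) (hq : q = Prod.fst ∨ q = Prod.snd)
    (K : Set Pt) (hK : IsCompact K) (hKU : K ⊆ UHP) (M : ℝ≥0) :
    IsCompact {z : EOm | q z.1 ∈ K ∧ costN p z ≤ M} := by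
  have hqc : Continuous q := by
    rcases hq with rfl | rfl <;> fun_prop
  rw [Topology.IsInducing.subtypeVal.isCompact_iff]
  set r : ℝ≥0 := M ^ (1 / p) with hr
  have hp0 : 0 < p := by linarith
  have himg : Subtype.val '' {z : EOm | q z.1 ∈ K ∧ costN p z ≤ M} =
      (UHPbar ×ˢ UHPbar) ∩ (q ⁻¹' K ∩ {w | nndist w.1 w.2 ^ p ≤ M}) := by
    ext w
    constructor
    · rintro ⟨z, ⟨h1, h2⟩, rfl⟩
      exact ⟨z.2.1, h1, h2⟩
    · rintro ⟨h1, h2, h3⟩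
      have hwE : w ∈ EOm := by
        refine ⟨h1, fun hD => ?_⟩
        have : q w ∈ Diag := by
          rcases hq with rfl | rfl
          · exact hD.1
          · exact hD.2
        exact not_mem_Diag (hKU h2) this
      exact ⟨⟨w, hwE⟩, ⟨h2, h3⟩, rfl⟩
  rw [himg]
  have hcl : IsClosed {w : Pt × Pt | nndist w.1 w.2 ^ p ≤ M} := by
    have h : Continuous fun t : ℝ≥0 => t ^ p := NNReal.continuous_rpow_const hp0.le
    exact isClosed_le (h.comp (by fun_prop)) continuous_const
  refine ((hK.cthickening (r := r)).prod (hK.cthickening (r := r))).of_isClosed_subset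
    ((isClosed_UHPbar.prod isClosed_UHPbar).inter ((hK.isClosed.preimage hqc).inter hcl)) ?_
  rintro w ⟨-, h1, h2⟩
  have hd : dist w.1 w.2 ≤ r := by
    have h3 : nndist w.1 w.2 ≤ r := by
      rw [hr, one_div]
      exact (NNReal.le_rpow_inv_iff hp0).2 h2
    exact_mod_cast h3
  rcases hq with rfl | rfl
  · exact ⟨mem_cthickening_of_dist_le _ w.1 _ _ h1 (by simp),
      mem_cthickening_of_dist_le _ w.1 _ _ h1 (by rwa [dist_comm])⟩
  · exact ⟨mem_cthickening_of_dist_le _ w.2 _ _ h1 hd,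
      mem_cthickening_of_dist_le _ w.2 _ _ h1 (by simp)⟩

/-- The core of the argument: bounded-cost plans along an ultrafilter give a limit plan. -/
lemma OTe_le_of_ultrafilter {p : ℝ} (hp : 1 ≤ p) {μs νs : ℕ → Measure Pt} {μ ν : Measure Pt}
    (hμs : ∀ n, MemMp p (μs n)) (hνs : ∀ n, MemMp p (νs n))
    (hμ : MemMp p μ) (hν : MemMp p ν)
    (hμv : VagueTendsto μs μ) (hνv : VagueTendsto νs ν)
    (U : Ultrafilter ℕ) (hU : (U : Filter ℕ) ≤ atTop) (C : ℝ≥0)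
    (πs : ℕ → Measure (Pt × Pt))
    (hπ : ∀ᶠ n in (U : Filter ℕ), πs n ∈ Adm (μs n) (νs n) ∧ Cost p (πs n) ≤ C) :
    OTe p μ ν ≤ C := by
  have hlc : LocallyCompactSpace EOm := isLocallyClosed_EOm.locallyCompactSpace
  set σs : ℕ → Measure EOm := fun n => (πs n).comap Subtype.val with hσs
  have hb : ∀ K : Set EOm, IsCompact K → ∃ C : ℝ≥0, ∀ᶠ n in (U : Filter ℕ), σs n K ≤ C := by
    intro K hK
    obtain ⟨K₁, K₂, hK₁, hK₂, hU₁, hU₂, rfl⟩ := hK.binary_compact_cover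
      (U := {z : EOm | z.1.1 ∈ UHP}) (V := {z : EOm | z.1.2 ∈ UHP})
      (isOpen_UHP.preimage (by fun_prop)) (isOpen_UHP.preimage (by fun_prop)) (by
        rintro ⟨z, hz⟩ -
        by_contra hcon
        simp only [mem_union, mem_ofPred_eq, not_or] at hcon
        exact hz.2 ⟨hz.1.1.resolve_left hcon.1, hz.1.2.resolve_left hcon.2⟩)
    have hI₁ : IsCompact ((fun z : EOm => z.1.1) '' K₁) := hK₁.image (by fun_prop)
    have hI₂ : IsCompact ((fun z : EOm => z.1.2) '' K₂) := hK₂.image (by fun_prop)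
    have hS₁ : (fun z : EOm => z.1.1) '' K₁ ⊆ UHP := by
      rintro _ ⟨z, hz, rfl⟩; exact hU₁ hz
    have hS₂ : (fun z : EOm => z.1.2) '' K₂ ⊆ UHP := by
      rintro _ ⟨z, hz, rfl⟩; exact hU₂ hz
    obtain ⟨C₁, hC₁⟩ := vague_bdd hp hμs hμ hμv hI₁ hS₁
    obtain ⟨C₂, hC₂⟩ := vague_bdd hp hνs hν hνv hI₂ hS₂
    refine ⟨C₁ + C₂, ?_⟩
    filter_upwards [hU hC₁, hU hC₂, hπ] with n h₁ h₂ h₃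
    obtain ⟨⟨-, hm1, hm2⟩, -⟩ := h₃
    refine (measure_union_le _ _).trans ?_
    push_cast
    refine add_le_add ?_ ?_
    · refine le_trans ?_ h₁
      rw [← hm1 _ hI₁.measurableSet hS₁, hσs]
      dsimp only
      rw [embEOm.comap_apply]
      apply measure_mono
      rintro _ ⟨z, hz, rfl⟩
      exact ⟨⟨z, hz, rfl⟩, mem_univ _⟩
    · refine le_trans ?_ h₂
      rw [← hm2 _ hI₂.measurableSet hS₂, hσs]
      dsimp only
      rw [embEOm.comap_apply]
      apply measure_mono
      rintro _ ⟨z, hz, rfl⟩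
      exact ⟨mem_univ _, ⟨z, hz, rfl⟩⟩
  obtain ⟨σ, hσ⟩ := exists_vague_limit U σs hb
  have hL : ∀ᶠ n in (U : Filter ℕ), ∫⁻ z, costN p z ∂(σs n) ≤ C := by
    filter_upwards [hπ] with n hn
    exact (cost_comap_le hp _).trans hn.2
  have hcost : ∫⁻ z, costN p z ∂σ ≤ C :=
    vague_lsc U σs σ hσ (costN p) (continuous_costN hp) (fun _ => C) C hL tendsto_const_nhds
  have hmem : σ.map Subtype.val ∈ Adm μ ν := by
    refine ⟨?_, ?_, ?_⟩
    · rw [embEOm.map_apply]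
      convert measure_empty (μ := σ)
      ext z
      simp only [mem_preimage, mem_compl_iff, mem_empty_iff_false, iff_false, not_not]
      exact z.2.1
    · intro A hA hAU
      rw [embEOm.map_apply]
      have := marginal_limit hp hμs hμ hμv U hU σs σ hσ (fun z : EOm => z.1.1) (by fun_prop)
        (costN p) (continuous_costN hp)
        (fun K hK hKU M => costN_proper hp Prod.fst (Or.inl rfl) K hK hKU M) C hL (by
          filter_upwards [hπ] with n hn g hg hgc hgU
          refine plan_marg (hμs n).1 hn.1.1 Prod.fst measurable_fst (fun z hz => hz.1) ?_ g hg hgU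
          intro A hA hAU
          rw [← hn.1.2.1 A hA hAU]
          congr 1
          ext; simp) hA hAU
      rw [← this]
      congr 1
      ext; simp
    · intro A hA hAU
      rw [embEOm.map_apply]
      have := marginal_limit hp hνs hν hνv U hU σs σ hσ (fun z : EOm => z.1.2) (by fun_prop)
        (costN p) (continuous_costN hp)
        (fun K hK hKU M => costN_proper hp Prod.snd (Or.inr rfl) K hK hKU M) C hL (by
          filter_upwards [hπ] with n hn g hg hgc hgU
          refine plan_marg (hνs n).1 hn.1.1 Prod.snd measurable_snd (fun z hz => hz.2) ?_ g hg hgU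
          intro A hA hAU
          rw [← hn.1.2.2 A hA hAU]
          congr 1
          ext; simp) hA hAU
      rw [← this]
      congr 1
      ext; simp
  refine (iInf₂_le _ hmem).trans ?_
  rw [Cost, embEOm.lintegral_map]
  simp_rw [← coe_costN hp]
  exact hcost

/-- OT_p is lower semi-continuous with respect to vague convergence. -/
theorem stmt4 (p : ℝ) (hp : 1 ≤ p) (μs νs : ℕ → Measure Pt) (μ ν : Measure Pt)
    (hμs : ∀ n, MemMp p (μs n)) (hνs : ∀ n, MemMp p (νs n))
    (hμ : MemMp p μ) (hν : MemMp p ν)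
    (hμv : VagueTendsto μs μ) (hνv : VagueTendsto νs ν) :
    OTe p μ ν ^ (1 / p) ≤
      Filter.liminf (fun n => OTe p (μs n) (νs n) ^ (1 / p)) atTop := by
  have hp0 : 0 < p := by linarith
  by_contra hcon
  rw [not_le] at hcon
  obtain ⟨b, hb1, hb2⟩ := exists_between hcon
  have hfreq : ∃ᶠ n in atTop, OTe p (μs n) (νs n) ^ (1 / p) < b := frequently_lt_of_liminf_lt (by isBoundedDefault) hb1
  have hbtop : b ≠ ⊤ := ne_top_of_lt hb2
  have hCtop : b ^ p ≠ ⊤ := ENNReal.rpow_ne_top_of_nonneg hp0.le hbtop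
  have hne : NeBot (atTop ⊓ 𝓟 {n | OTe p (μs n) (νs n) ^ (1 / p) < b}) :=
    frequently_mem_iff_neBot.1 hfreq
  obtain ⟨U, hU⟩ := Ultrafilter.exists_le (atTop ⊓ 𝓟 {n | OTe p (μs n) (νs n) ^ (1 / p) < b})
  have hU1 : (U : Filter ℕ) ≤ atTop := hU.trans inf_le_left
  have hU2 : ∀ᶠ n in (U : Filter ℕ), OTe p (μs n) (νs n) ^ (1 / p) < b :=
    le_principal_iff.1 (hU.trans inf_le_right)
  have hex : ∀ n, ∃ π : Measure (Pt × Pt), OTe p (μs n) (νs n) ^ (1 / p) < b →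
      π ∈ Adm (μs n) (νs n) ∧ Cost p π ≤ ((b ^ p).toNNReal : ℝ≥0∞) := by
    intro n
    by_cases hn : OTe p (μs n) (νs n) ^ (1 / p) < b
    · have h1 : OTe p (μs n) (νs n) < b ^ p := by
        rw [one_div] at hn
        exact (ENNReal.rpow_inv_lt_iff hp0).1 hn
      rw [OTe] at h1
      obtain ⟨π, hπ⟩ := iInf_lt_iff.1 h1
      obtain ⟨hmem, hlt⟩ := iInf_lt_iff.1 hπ
      refine ⟨π, fun _ => ⟨hmem, ?_⟩⟩
      rw [ENNReal.coe_toNNReal hCtop]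
      exact hlt.le
    · exact ⟨0, fun h => absurd h hn⟩
  choose πs hπs using hex
  have hfin := OTe_le_of_ultrafilter hp hμs hνs hμ hν hμv hνv U hU1 (b ^ p).toNNReal πs
    (hU2.mono fun n hn => hπs n hn)
  rw [ENNReal.coe_toNNReal hCtop] at hfin
  rw [one_div] at hb2
  exact absurd ((ENNReal.rpow_inv_le_iff hp0).2 hfin) (not_le.2 hb2)
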